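/- Wave equation for the second auxiliary function Φ₂: let N₁ ∈ ℕ and let u : (0,T) × (0,∞) → ℝ be a C² function satisfying, for all (t,r), (1 + 2 sin²u/r²)(∂ₜₜu − ∂ᵣᵣu) − (2/r)∂ᵣu + (sin 2u / r²)(1 + (∂ₜu)² − (∂ᵣu)² + sin²u/r²) = 0. Define Φ₂(t,r) = (1/r) ∫_{N₁π}^{u(t,r)} A(r,w)^{1/2} dw. Then for all (t,r) ∈ (0,T) × (0,∞), ∂ₜₜΦ₂ − ∂ᵣᵣΦ₂ − (4/r)∂ᵣΦ₂ = −(3/2)Φ₂ + (1/(2r)) ∫_{N₁π}^{u(t,r)} [ 3A(r,w)^{3/2} + A(r,w)^{-1/2} − A(r,w)^{-3/2} ] dw. -/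

import Mathlib

open Real Set

/-- Time partial derivative. -/
noncomputable def pdt (f : ℝ → ℝ → ℝ) : ℝ → ℝ → ℝ :=
  fun t r => deriv (fun s => f s r) t

/-- Radial partial derivative. -/
noncomputable def pdr (f : ℝ → ℝ → ℝ) : ℝ → ℝ → ℝ :=
  fun t r => deriv (fun s => f t s) r

/-- `A(r,w) = 1 + 2 sin² w / r²`. -/
noncomputable def Afun (r w : ℝ) : ℝ := 1 + 2 * Real.sin w ^ 2 / r ^ 2

open Filter Topology MeasureTheory intervalIntegral

/-- The integral `∫_c^y f x w dw`, with `f` and its `x`-derivative `f'` jointly continuous, is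
jointly strictly differentiable in `(x, y)`; this is the resulting Leibniz rule along a curve. -/
lemma hasDerivAt_integral_param_endpoint {f f' : ℝ → ℝ → ℝ}
    (hf : Continuous (Function.uncurry f)) (hf' : Continuous (Function.uncurry f'))
    (hd : ∀ x w, HasDerivAt (fun y => f y w) (f' x w) x) (c : ℝ)
    {g v : ℝ → ℝ} {g' v' r : ℝ} (hg : HasDerivAt g g' r) (hv : HasDerivAt v v' r) :
    HasDerivAt (fun ρ => ∫ w in c..v ρ, f (g ρ) w)
      ((∫ w in c..v r, f' (g r) w) * g' + f (g r) (v r) * v') r := by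
  have hfx : ∀ x, Continuous (f x) := fun x => hf.comp (by fun_prop : Continuous fun w => (x, w))
  have hfx' : ∀ x, Continuous (f' x) := fun x => hf'.comp (by fun_prop : Continuous fun w => (x, w))
  have d1 : ∀ x y, HasDerivAt (fun z => ∫ w in c..y, f z w) (∫ w in c..y, f' x w) x := by
    intro x y
    obtain ⟨C, hC⟩ := ((isCompact_closedBall x 1).prod
      (isCompact_uIcc (a := c) (b := y))).exists_bound_of_continuousOn hf'.continuousOn
    refine (hasDerivAt_integral_of_dominated_loc_of_deriv_le (F := f) (F' := f')
      (bound := fun _ => C) (Metric.closedBall_mem_nhds x one_pos)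
      (.of_forall fun z => (hfx z).aestronglyMeasurable) ((hfx x).intervalIntegrable _ _)
      (hfx' x).aestronglyMeasurable (.of_forall fun w hw z hz => ?_)
      intervalIntegrable_const (.of_forall fun w _ z _ => hd z w)).2
    exact hC (z, w) ⟨hz, uIoc_subset_uIcc hw⟩
  have d2 : ∀ x y, HasDerivAt (fun z => ∫ w in c..z, f x w) (f x y) y := fun x y =>
    ((hfx x).integral_hasStrictDerivAt c y).hasDerivAt
  have hI : Continuous fun p : ℝ × ℝ => ∫ w in c..p.2, f' p.1 w :=
    continuous_parametric_intervalIntegral_of_continuous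
      (f := fun (p : ℝ × ℝ) w => f' p.1 w)
      (hf'.comp (by fun_prop : Continuous fun p : (ℝ × ℝ) × ℝ => (p.1.1, p.2))) continuous_snd
  have key := hasStrictFDerivAt_uncurry_coprod (𝕜 := ℝ) (u := (g r, v r))
    (f := fun x y => ∫ w in c..y, f x w)
    (f₁ := fun x y => ContinuousLinearMap.toSpanSingleton ℝ (∫ w in c..y, f' x w))
    (f₂ := fun x y => ContinuousLinearMap.toSpanSingleton ℝ (f x y))
    (.of_forall fun p => (d1 p.1 p.2).hasFDerivAt) (.of_forall fun p => (d2 p.1 p.2).hasFDerivAt)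
    ((ContinuousLinearMap.toSpanSingletonCLE (𝕜 := ℝ) (E := ℝ)).continuous.comp hI).continuousAt
    ((ContinuousLinearMap.toSpanSingletonCLE (𝕜 := ℝ) (E := ℝ)).continuous.comp hf).continuousAt
  have h := key.hasFDerivAt.comp_hasDerivAt r (hg.prodMk hv)
  refine h.congr_deriv ?_
  simp [Function.HasUncurry.uncurry, mul_comm]

lemma Afun_pos (r w : ℝ) : 0 < Afun r w := by
  unfold Afun; positivity

lemma continuous_Afun_rpow (r p : ℝ) : Continuous fun w => Afun r w ^ p := by
  refine Continuous.rpow_const ?_ fun w => .inl (Afun_pos r w).ne'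
  unfold Afun; fun_prop

lemma intervalIntegrable_Afun_rpow (r p a b : ℝ) :
    IntervalIntegrable (fun w => Afun r w ^ p) volume a b :=
  (continuous_Afun_rpow r p).intervalIntegrable a b

lemma hasDerivAt_Afun_rpow_snd (r p w : ℝ) :
    HasDerivAt (fun x => Afun r x ^ p) (p * Afun r w ^ (p - 1) * (2 * sin (2 * w) / r ^ 2)) w := by
  have h : HasDerivAt (fun x => Afun r x) (2 * sin (2 * w) / r ^ 2) w := by
    unfold Afun
    refine (((((hasDerivAt_sin w).pow 2).const_mul 2).div_const (r ^ 2)).const_add 1).congr_deriv ?_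
    rw [sin_two_mul]; push_cast; ring
  refine (h.rpow_const (.inl (Afun_pos r w).ne')).congr_deriv ?_
  ring

lemma hasDerivAt_Afun_rpow_curve (p : ℝ) {v : ℝ → ℝ} {v' r : ℝ} (hr : 0 < r)
    (hv : HasDerivAt v v' r) :
    HasDerivAt (fun ρ => Afun ρ (v ρ) ^ p)
      (p * Afun r (v r) ^ (p - 1)
        * (2 * sin (2 * v r) / r ^ 2 * v' - 2 / r * (Afun r (v r) - 1))) r := by
  have h : HasDerivAt (fun ρ => Afun ρ (v ρ))
      (2 * sin (2 * v r) / r ^ 2 * v' - 2 / r * (Afun r (v r) - 1)) r := by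
    unfold Afun
    refine ((((hv.sin.pow 2).const_mul 2).div (hasDerivAt_pow 2 r)
      (by positivity)).const_add 1).congr_deriv ?_
    rw [sin_two_mul]
    simp only [Pi.pow_apply]
    push_cast
    field_simp
    ring
  refine (h.rpow_const (.inl (Afun_pos r _).ne')).congr_deriv ?_
  ring

lemma hasDerivAt_integral_Afun_rpow {p q : ℝ} (hq : q = p - 1) (c : ℝ) {v : ℝ → ℝ} {v' r : ℝ}
    (hr : 0 < r) (hv : HasDerivAt v v' r) :
    HasDerivAt (fun ρ => ∫ w in c..v ρ, Afun ρ w ^ p)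
      (Afun r (v r) ^ p * v'
        - 2 * p / r * ((∫ w in c..v r, Afun r w ^ p) - ∫ w in c..v r, Afun r w ^ q)) r := by
  subst hq
  -- In the variable `x = 1 / r` the integrand is smooth on the whole plane.
  have hpos : ∀ x w : ℝ, 0 < 1 + 2 * sin w ^ 2 * x ^ 2 := fun x w => by positivity
  have hA : ∀ ρ w, 1 + 2 * sin w ^ 2 * ρ⁻¹ ^ 2 = Afun ρ w := fun ρ w => by
    unfold Afun; rw [inv_pow, div_eq_mul_inv]
  have hpow : ∀ s : ℝ, Continuous fun z : ℝ × ℝ => (1 + 2 * sin z.2 ^ 2 * z.1 ^ 2) ^ s := fun s =>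
    Continuous.rpow_const (by fun_prop) fun z => .inl (hpos z.1 z.2).ne'
  have hf' : Continuous fun z : ℝ × ℝ =>
      4 * sin z.2 ^ 2 * z.1 * p * (1 + 2 * sin z.2 ^ 2 * z.1 ^ 2) ^ (p - 1) :=
    Continuous.mul (by fun_prop) (hpow (p - 1))
  have hd : ∀ x w, HasDerivAt (fun y : ℝ => (1 + 2 * sin w ^ 2 * y ^ 2) ^ p)
      (4 * sin w ^ 2 * x * p * (1 + 2 * sin w ^ 2 * x ^ 2) ^ (p - 1)) x := fun x w => by
    have := (((hasDerivAt_pow 2 x).const_mul (2 * sin w ^ 2)).const_add 1).rpow_const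
      (p := p) (.inl (hpos x w).ne')
    refine this.congr_deriv ?_
    push_cast
    ring
  have h := hasDerivAt_integral_param_endpoint
    (f := fun x w => (1 + 2 * sin w ^ 2 * x ^ 2) ^ p)
    (f' := fun x w => 4 * sin w ^ 2 * x * p * (1 + 2 * sin w ^ 2 * x ^ 2) ^ (p - 1))
    (hpow p) hf' hd c (hasDerivAt_inv hr.ne') hv
  simp only [hA] at h
  refine h.congr_deriv ?_
  have e : ∀ w, 4 * sin w ^ 2 * r⁻¹ * p * Afun r w ^ (p - 1)
      = 2 * p * r * (Afun r w ^ p - Afun r w ^ (p - 1)) := fun w => by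
    have : Afun r w ^ p = Afun r w ^ (p - 1) * Afun r w := by
      rw [← rpow_add_one (Afun_pos r w).ne']; ring_nf
    rw [this]
    generalize Afun r w ^ (p - 1) = X
    unfold Afun
    field_simp
    ring
  simp only [e]
  rw [intervalIntegral.integral_const_mul, intervalIntegral.integral_sub (intervalIntegrable_Afun_rpow _ _ _ _)
    (intervalIntegrable_Afun_rpow _ _ _ _)]
  field_simp
  ring

lemma Afun_rpow_half_powers (r w : ℝ) :
    0 < Afun r w ^ ((1:ℝ)/2) ∧ Afun r w = (Afun r w ^ ((1:ℝ)/2)) ^ 2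
      ∧ Afun r w ^ ((3:ℝ)/2) = (Afun r w ^ ((1:ℝ)/2)) ^ 3
      ∧ Afun r w ^ (-(1:ℝ)/2) = (Afun r w ^ ((1:ℝ)/2))⁻¹
      ∧ Afun r w ^ (-(3:ℝ)/2) = ((Afun r w ^ ((1:ℝ)/2)) ^ 3)⁻¹ := by
  have h := Afun_pos r w
  refine ⟨rpow_pos_of_pos h _, ?_, ?_, ?_, ?_⟩
  · rw [← rpow_mul_natCast h.le]; norm_num
  · rw [← rpow_mul_natCast h.le]; norm_num
  · rw [← rpow_neg h.le]; norm_num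
  · rw [← rpow_mul_natCast h.le, ← rpow_neg h.le]; norm_num

/-- Integration of the total derivative of `(A^{-1/2} + A^{1/2}) sin 2w / r²`. -/
lemma integral_Afun_rpow_identity (N : ℕ) (U : ℝ) {r : ℝ} (hr : 0 < r) :
    (∫ w in ((N : ℝ) * π)..U,
        (3 * Afun r w ^ ((3:ℝ)/2) + Afun r w ^ (-(1:ℝ)/2) - Afun r w ^ (-(3:ℝ)/2)))
      = (3 + 4 / r ^ 2) * (∫ w in ((N : ℝ) * π)..U, Afun r w ^ ((1:ℝ)/2))
        - 2 / r ^ 2 * (∫ w in ((N : ℝ) * π)..U, Afun r w ^ (-(1:ℝ)/2))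
        + 2 / r ^ 2 * (∫ w in ((N : ℝ) * π)..U, Afun r w ^ (-(3:ℝ)/2))
        - (Afun r U ^ (-(1:ℝ)/2) + Afun r U ^ ((1:ℝ)/2)) * (sin (2 * U) / r ^ 2) := by
  have hd : ∀ w, HasDerivAt
      (fun x => (Afun r x ^ (-(1:ℝ)/2) + Afun r x ^ ((1:ℝ)/2)) * (sin (2 * x) / r ^ 2))
      ((3 + 4 / r ^ 2) * Afun r w ^ ((1:ℝ)/2) - 2 / r ^ 2 * Afun r w ^ (-(1:ℝ)/2)
        + 2 / r ^ 2 * Afun r w ^ (-(3:ℝ)/2)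
        - (3 * Afun r w ^ ((3:ℝ)/2) + Afun r w ^ (-(1:ℝ)/2) - Afun r w ^ (-(3:ℝ)/2))) w := by
    intro w
    have hs : HasDerivAt (fun x : ℝ => sin (2 * x) / r ^ 2) (cos (2 * w) * 2 / r ^ 2) w := by
      have := ((hasDerivAt_id w).const_mul (2:ℝ)).sin.div_const (r ^ 2)
      simpa using this
    refine (((hasDerivAt_Afun_rpow_snd r (-(1:ℝ)/2) w).add
      (hasDerivAt_Afun_rpow_snd r ((1:ℝ)/2) w)).mul hs).congr_deriv ?_
    rw [show -(1:ℝ)/2 - 1 = -(3:ℝ)/2 by norm_num, show (1:ℝ)/2 - 1 = -(1:ℝ)/2 by norm_num]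
    obtain ⟨h0, h1, h2, h3, h4⟩ := Afun_rpow_half_powers r w
    rw [h2, h3, h4]
    have hS : sin w ^ 2 = ((Afun r w ^ ((1:ℝ)/2)) ^ 2 - 1) * r ^ 2 / 2 := by
      rw [← h1]; unfold Afun; field_simp; ring
    have hc : cos (2 * w) = 1 - 2 * sin w ^ 2 := by rw [cos_two_mul, cos_sq']; ring
    have hss : sin (2 * w) ^ 2 = 4 * sin w ^ 2 * (1 - sin w ^ 2) := by
      rw [sin_two_mul, ← cos_sq']; ring
    rw [hS] at hc hss
    simp only [Pi.add_apply]
    rw [hc, h3]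
    generalize Afun r w ^ ((1:ℝ)/2) = s at *
    have hz : (s⁻¹ - (s ^ 3)⁻¹) / r ^ 4 * (sin (2 * w) ^ 2 - 4 * ((s ^ 2 - 1) * r ^ 2 / 2) *
        (1 - (s ^ 2 - 1) * r ^ 2 / 2)) = 0 := by rw [hss]; ring
    rw [← sub_eq_zero, ← hz]
    field_simp
    ring
  have hi := intervalIntegrable_Afun_rpow r
  have hF := integral_eq_sub_of_hasDerivAt (a := (N : ℝ) * π) (b := U) (fun w _ => hd w)
    (((((hi _ _ _).const_mul _).sub ((hi _ _ _).const_mul _)).add ((hi _ _ _).const_mul _)).sub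
      ((((hi _ _ _).const_mul _).add (hi _ _ _)).sub (hi _ _ _)))
  have h0 : sin (2 * ((N : ℝ) * π)) = 0 := by
    rw [← mul_assoc]; exact_mod_cast sin_nat_mul_pi (2 * N)
  rw [h0, integral_sub
    ((((hi _ _ _).const_mul _).sub ((hi _ _ _).const_mul _)).add ((hi _ _ _).const_mul _))
      ((((hi _ _ _).const_mul _).add (hi _ _ _)).sub (hi _ _ _)),
    integral_add (((hi _ _ _).const_mul _).sub ((hi _ _ _).const_mul _)) ((hi _ _ _).const_mul _),
    integral_sub ((hi _ _ _).const_mul _) ((hi _ _ _).const_mul _), intervalIntegral.integral_const_mul,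
    intervalIntegral.integral_const_mul, intervalIntegral.integral_const_mul] at hF
  linear_combination -hF

lemma ContDiffOn.hasDerivAt_deriv_deriv {f : ℝ → ℝ} {s : Set ℝ} (hs : IsOpen s)
    (hf : ContDiffOn ℝ 2 f s) {x : ℝ} (hx : x ∈ s) :
    HasDerivAt f (deriv f x) x ∧ HasDerivAt (deriv f) (deriv (deriv f) x) x := by
  have h1 : ContDiffOn ℝ 1 (deriv f) s := hf.deriv_of_isOpen hs (by norm_num)
  exact ⟨((hf.differentiableOn (by norm_num)).differentiableAt (hs.mem_nhds hx)).hasDerivAt,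
    ((h1.differentiableOn (by norm_num)).differentiableAt (hs.mem_nhds hx)).hasDerivAt⟩

/-- Wave equation for the second auxiliary function
`Φ₂(t,r) = (1/r) ∫_{N₁π}^{u(t,r)} A(r,w)^{1/2} dw`. -/
theorem wave_equation_Phi2
    (T : ℝ) (N₁ : ℕ) (u : ℝ → ℝ → ℝ)
    (hu : ContDiffOn ℝ 2 (Function.uncurry u) (Set.Ioo 0 T ×ˢ Set.Ioi (0:ℝ)))
    (hPDE : ∀ t ∈ Set.Ioo (0:ℝ) T, ∀ r ∈ Set.Ioi (0:ℝ),
      (1 + 2 * Real.sin (u t r) ^ 2 / r ^ 2) * (pdt (pdt u) t r - pdr (pdr u) t r)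
        - (2 / r) * pdr u t r
        + (Real.sin (2 * u t r) / r ^ 2) *
            (1 + (pdt u t r) ^ 2 - (pdr u t r) ^ 2 + Real.sin (u t r) ^ 2 / r ^ 2) = 0)
    (Φ₂ : ℝ → ℝ → ℝ)
    (hΦ₂ : ∀ t r, Φ₂ t r
      = (1 / r) * ∫ w in ((N₁ : ℝ) * Real.pi)..(u t r), (Afun r w) ^ ((1:ℝ)/2)) :
    ∀ t ∈ Set.Ioo (0:ℝ) T, ∀ r ∈ Set.Ioi (0:ℝ),
      pdt (pdt Φ₂) t r - pdr (pdr Φ₂) t r - (4 / r) * pdr Φ₂ t r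
        = -(3 / 2) * Φ₂ t r
          + (1 / (2 * r)) * ∫ w in ((N₁ : ℝ) * Real.pi)..(u t r),
              (3 * (Afun r w) ^ ((3:ℝ)/2)
                + (Afun r w) ^ (-(1:ℝ)/2) - (Afun r w) ^ (-(3:ℝ)/2)) := by
  intro t ht r hr
  have hr0 : (0:ℝ) < r := hr
  have hR : ∀ ρ ∈ Ioi (0:ℝ), HasDerivAt (u t) (pdr u t ρ) ρ ∧
      HasDerivAt (pdr u t) (pdr (pdr u) t ρ) ρ := fun ρ hρ =>
    ContDiffOn.hasDerivAt_deriv_deriv isOpen_Ioi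
      (hu.comp (f := fun ρ => (t, ρ)) (by fun_prop) fun ρ hρ => ⟨ht, hρ⟩) hρ
  have hT : ∀ τ ∈ Ioo (0:ℝ) T, HasDerivAt (fun s => u s r) (pdt u τ r) τ ∧
      HasDerivAt (fun s => pdt u s r) (pdt (pdt u) τ r) τ := fun τ hτ =>
    ContDiffOn.hasDerivAt_deriv_deriv isOpen_Ioo
      (hu.comp (f := fun τ => (τ, r)) (by fun_prop) fun τ hτ => ⟨hτ, hr⟩) hτ
  set c : ℝ := (N₁ : ℝ) * π with hc
  have eT1 : ∀ τ ∈ Ioo (0:ℝ) T, pdt Φ₂ τ r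
      = 1 / r * (Afun r (u τ r) ^ ((1:ℝ)/2) * pdt u τ r) := fun τ hτ => by
    have hF : HasDerivAt (fun y => ∫ w in c..y, Afun r w ^ ((1:ℝ)/2))
        (Afun r (u τ r) ^ ((1:ℝ)/2)) (u τ r) :=
      ((continuous_Afun_rpow r _).integral_hasStrictDerivAt c _).hasDerivAt
    have h := (hF.comp τ (hT τ hτ).1).const_mul (1 / r)
    simp only [pdt, hΦ₂]
    exact h.deriv
  have eT2 : pdt (pdt Φ₂) t r
      = 1 / r * (Afun r (u t r) ^ (-(1:ℝ)/2) * (sin (2 * u t r) / r ^ 2) * pdt u t r ^ 2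
        + Afun r (u t r) ^ ((1:ℝ)/2) * pdt (pdt u) t r) := by
    have hA := (hasDerivAt_Afun_rpow_snd r ((1:ℝ)/2) (u t r)).comp t (hT t ht).1
    have h := (hA.mul (hT t ht).2).const_mul (1 / r)
    have hev : (fun τ => pdt Φ₂ τ r) =ᶠ[𝓝 t]
        fun τ => 1 / r * (Afun r (u τ r) ^ ((1:ℝ)/2) * pdt u τ r) := by
      filter_upwards [isOpen_Ioo.mem_nhds ht] with τ hτ using eT1 τ hτ
    refine (hev.deriv_eq.trans h.deriv).trans ?_
    rw [show (1:ℝ)/2 - 1 = -(1:ℝ)/2 by norm_num]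
    simp only [Function.comp_apply]
    ring
  have eR1 : ∀ ρ ∈ Ioi (0:ℝ), pdr Φ₂ t ρ
      = Afun ρ (u t ρ) ^ ((1:ℝ)/2) * pdr u t ρ / ρ
        - (2 * (∫ w in c..u t ρ, Afun ρ w ^ ((1:ℝ)/2))
          - ∫ w in c..u t ρ, Afun ρ w ^ (-(1:ℝ)/2)) / ρ ^ 2 := fun ρ hρ => by
    have hρ0 : (0:ℝ) < ρ := hρ
    have h := (hasDerivAt_inv hρ0.ne').mul (hasDerivAt_integral_Afun_rpow
      (p := (1:ℝ)/2) (q := -(1:ℝ)/2) (by norm_num) c hρ0 (hR ρ hρ).1)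
    simp only [pdr, hΦ₂, one_div] at h ⊢
    refine h.deriv.trans ?_
    field_simp
    ring
  have eR2 : pdr (pdr Φ₂) t r
      = ((Afun r (u t r) ^ (-(1:ℝ)/2) * (sin (2 * u t r) / r ^ 2 * pdr u t r
            - 1 / r * (Afun r (u t r) - 1)) * pdr u t r
          + Afun r (u t r) ^ ((1:ℝ)/2) * pdr (pdr u) t r) * r
          - Afun r (u t r) ^ ((1:ℝ)/2) * pdr u t r) / r ^ 2
        - ((2 * (Afun r (u t r) ^ ((1:ℝ)/2) * pdr u t r
              - 1 / r * ((∫ w in c..u t r, Afun r w ^ ((1:ℝ)/2))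
                - ∫ w in c..u t r, Afun r w ^ (-(1:ℝ)/2)))
            - (Afun r (u t r) ^ (-(1:ℝ)/2) * pdr u t r
              + 1 / r * ((∫ w in c..u t r, Afun r w ^ (-(1:ℝ)/2))
                - ∫ w in c..u t r, Afun r w ^ (-(3:ℝ)/2)))) * r ^ 2
          - (2 * (∫ w in c..u t r, Afun r w ^ ((1:ℝ)/2))
              - ∫ w in c..u t r, Afun r w ^ (-(1:ℝ)/2)) * (2 * r)) / r ^ 4 := by
    have hv := (hR r hr).1
    have hA := hasDerivAt_Afun_rpow_curve ((1:ℝ)/2) hr0 hv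
    have hG := hasDerivAt_integral_Afun_rpow (p := (1:ℝ)/2) (q := -(1:ℝ)/2) (by norm_num) c hr0 hv
    have hH := hasDerivAt_integral_Afun_rpow (p := -(1:ℝ)/2) (q := -(3:ℝ)/2) (by norm_num) c hr0 hv
    have h := ((hA.mul (hR r hr).2).div (hasDerivAt_id r) hr0.ne').sub
      (((hG.const_mul 2).sub hH).div (hasDerivAt_pow 2 r) (by positivity))
    have hev : pdr Φ₂ t =ᶠ[𝓝 r] fun ρ => Afun ρ (u t ρ) ^ ((1:ℝ)/2) * pdr u t ρ / ρ
        - (2 * (∫ w in c..u t ρ, Afun ρ w ^ ((1:ℝ)/2))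
          - ∫ w in c..u t ρ, Afun ρ w ^ (-(1:ℝ)/2)) / ρ ^ 2 := by
      filter_upwards [isOpen_Ioi.mem_nhds hr] with ρ hρ using eR1 ρ hρ
    refine (hev.deriv_eq.trans h.deriv).trans ?_
    rw [show (1:ℝ)/2 - 1 = -(1:ℝ)/2 by norm_num]
    simp only [Pi.mul_apply, Pi.sub_apply, id_eq]
    push_cast
    field_simp
    ring
  have hP := hPDE t ht r hr
  have hA : 1 + 2 * sin (u t r) ^ 2 / r ^ 2 = Afun r (u t r) := rfl
  have hS : sin (u t r) ^ 2 / r ^ 2 = (Afun r (u t r) - 1) / 2 := by rw [← hA]; ring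
  rw [hA, hS] at hP
  rw [eT2, eR2, eR1 r hr, hΦ₂, integral_Afun_rpow_identity N₁ (u t r) hr0]
  obtain ⟨h0, h1, -, h3, -⟩ := Afun_rpow_half_powers r (u t r)
  rw [h3]
  rw [h1] at hP
  generalize Afun r (u t r) ^ ((1:ℝ)/2) = s at *
  rw [h1]
  generalize (∫ w in c..u t r, Afun r w ^ ((1:ℝ)/2)) = G
  generalize (∫ w in c..u t r, Afun r w ^ (-(1:ℝ)/2)) = H
  generalize (∫ w in c..u t r, Afun r w ^ (-(3:ℝ)/2)) = K
  generalize pdt (pdt u) t r = utt at *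
  generalize pdr (pdr u) t r = urr at *
  generalize pdt u t r = ut at *
  generalize pdr u t r = ur at *
  generalize sin (2 * u t r) = S at *
  rw [← sub_eq_zero, ← mul_zero (s⁻¹ / r), ← hP]
  field_simp
  ring
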